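/- Let V be an invertible N×N complex matrix, W = (V⁻¹)ᴴ, and let {S_1, …, S_k} be a partition of the index set {1, …, N}. For a signal s ∈ ℂᴺ, define the energy of the i-th spectral component as ‖s̆_i‖² := Σ_{j ∈ S_i} (V⁻¹s)_j · conj((Vᴴs)_j), where s̆_i = Σ_{j ∈ S_i} (V⁻¹s)_j v_j is the oblique projection of s onto the span of the columns of V indexed by S_i. Then the component energies sum to the total signal energy: Σ_{i=1}^{k} ‖s̆_i‖² = ‖s‖². -/

import Mathlib

open Matrix BigOperators

/-- The component energies of the AIM decomposition, defined via the generalized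
Parseval's identity with respect to a partition `S_1, …, S_k` of the column indices
of an invertible matrix `V` (with dual basis matrix `W = (V⁻¹)ᴴ`), sum to the total
signal energy `‖s‖²`. -/
theorem stmt1 (N k : ℕ) (V : Matrix (Fin N) (Fin N) ℂ) (hV : IsUnit V)
    (S : Fin k → Finset (Fin N))
    (hdisj : ∀ i j : Fin k, i ≠ j → Disjoint (S i) (S j))
    (hcover : (Finset.univ : Finset (Fin k)).biUnion S = Finset.univ)
    (s : Fin N → ℂ) :
    ∑ i : Fin k, ∑ j ∈ S i, (V⁻¹ *ᵥ s) j * (starRingEnd ℂ) ((Vᴴ *ᵥ s) j) =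
      ∑ j, s j * (starRingEnd ℂ) (s j) := by
  rw [← Finset.sum_biUnion (fun i _ j _ hij => hdisj i j hij), hcover]
  change (V⁻¹ *ᵥ s) ⬝ᵥ star (Vᴴ *ᵥ s) = s ⬝ᵥ star s
  rw [star_mulVec, conjTranspose_conjTranspose, dotProduct_comm, ← dotProduct_mulVec,
    mulVec_mulVec, mul_nonsing_inv V ((isUnit_iff_isUnit_det V).mp hV), one_mulVec,
    dotProduct_comm]
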